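/- Let p ≥ 1, N ≥ 2, q ≥ 2 be integers, and let φ: ℤ[X] → (ZMod q)[X]/(X^p + 1) denote the canonical ring homomorphism. Let s ∈ ℤ[X], and let c = (c₁, c₂) and d = (d₁, d₂) be pairs of elements of R := (ZMod q)[X]/(X^p+1) such that c₁ + c₂·φ(s) = φ(N·e₁ + m₁) and d₁ + d₂·φ(s) = φ(N·e₂ + m₂) for some e₁, e₂, m₁, m₂ ∈ ℤ[X]. Define Mult(c, d) := ( c₁d₁, c₁d₂ + c₂d₁, c₂d₂ ) ∈ R³. Then: (i) c₁d₁ + (c₁d₂ + c₂d₁)·φ(s) + c₂d₂·φ(s)² = φ( (N·e₁ + m₁)(N·e₂ + m₂) ); and (ii) if r ∈ ℤ[X] denotes the remainder of (N·e₁ + m₁)(N·e₂ + m₂) upon division by X^p + 1 in ℤ[X] and every coefficient of r lies in [−q/2, q/2), then r is the unique polynomial in ℤ[X] of degree < p with all coefficients in [−q/2, q/2) satisfying φ(r) = c₁d₁ + (c₁d₂ + c₂d₁)·φ(s) + c₂d₂·φ(s)², and the image of r under the canonical ring homomorphism ℤ[X] → (ZMod N)[X]/(X^p+1) equals the image of m₁·m₂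 under the same homomorphism. -/

import Mathlib

open Polynomial

/-- The canonical ring homomorphism `ℤ[X] → (ZMod q)[X]/(X^p + 1)`: coefficient-wise
reduction modulo `q` followed by the quotient map. -/
noncomputable def canonMap (p q : ℕ) :
    Polynomial ℤ →+*
      (Polynomial (ZMod q) ⧸ Ideal.span {((X : Polynomial (ZMod q)) ^ p + 1)}) :=
  (Ideal.Quotient.mk (Ideal.span {((X : Polynomial (ZMod q)) ^ p + 1)})).comp
    (Polynomial.mapRingHom (Int.castRingHom (ZMod q)))

theorem monic_X_pow_add_one (R : Type*) [Ring R] {p : ℕ} (hp : 1 ≤ p) :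
    ((X : Polynomial R) ^ p + 1).Monic := by
  simpa using monic_X_pow_add_C (R := R) 1 (by lia : p ≠ 0)

theorem canonMap_X_pow_add_one (p q : ℕ) : canonMap p q (X ^ p + 1) = 0 := by
  have h : (Polynomial.mapRingHom (Int.castRingHom (ZMod q))) (X ^ p + 1) = X ^ p + 1 := by
    simp
  rw [canonMap, RingHom.comp_apply, h, Ideal.Quotient.eq_zero_iff_mem]
  exact Ideal.mem_span_singleton_self _

theorem canonMap_modByMonic (p q : ℕ) (f : Polynomial ℤ) :
    canonMap p q (f %ₘ (X ^ p + 1)) = canonMap p q f := by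
  conv_rhs => rw [← modByMonic_add_div f (X ^ p + 1)]
  rw [map_add, map_mul, canonMap_X_pow_add_one, zero_mul, add_zero]

theorem canonMap_natCast_self (p N : ℕ) : canonMap p N (N : Polynomial ℤ) = 0 := by
  have h : (Polynomial.mapRingHom (Int.castRingHom (ZMod N))) (N : Polynomial ℤ) = 0 := by
    rw [map_natCast, ← C_eq_natCast, ZMod.natCast_self, C_0]
  rw [canonMap, RingHom.comp_apply, h, map_zero]

/-- Below degree `p`, the canonical map only identifies polynomials whose coefficients
agree modulo `q`. -/
theorem intCast_coeff_eq_of_canonMap_eq {p q : ℕ} (hp : 1 ≤ p) (hq : 2 ≤ q)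
    {f g : Polynomial ℤ} (hf : f.degree < (p : WithBot ℕ)) (hg : g.degree < (p : WithBot ℕ))
    (h : canonMap p q f = canonMap p q g) (i : ℕ) :
    ((f.coeff i : ℤ) : ZMod q) = (g.coeff i : ℤ) := by
  have : Fact (1 < q) := ⟨hq⟩
  rw [canonMap, RingHom.comp_apply, RingHom.comp_apply, Ideal.Quotient.eq,
    Ideal.mem_span_singleton, ← map_sub] at h
  have hdeg : (mapRingHom (Int.castRingHom (ZMod q)) (f - g)).degree <
      ((X : Polynomial (ZMod q)) ^ p + 1).degree := by
    have hX : ((X : Polynomial (ZMod q)) ^ p + 1).degree = p := by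
      simpa using degree_X_pow_add_C (R := ZMod q) (by lia : 0 < p) 1
    rw [hX, coe_mapRingHom]
    exact degree_map_le.trans_lt ((degree_sub_le f g).trans_lt (max_lt hf hg))
  have hzero := by_contra fun hne =>
    (monic_X_pow_add_one (ZMod q) hp).not_dvd_of_degree_lt hne hdeg h
  have hcoeff := congrArg (fun u => u.coeff i) hzero
  simpa [sub_eq_zero] using hcoeff

/-- Two integers in `[-q/2, q/2)` that are congruent modulo `q` are equal. -/
theorem eq_of_intCast_eq_of_mem_centered {q : ℕ} {a b : ℤ}
    (ha : -(q : ℤ) ≤ 2 * a ∧ 2 * a < (q : ℤ)) (hb : -(q : ℤ) ≤ 2 * b ∧ 2 * b < (q : ℤ))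
    (h : (a : ZMod q) = (b : ZMod q)) : a = b := by
  rw [ZMod.intCast_eq_intCast_iff_dvd_sub] at h
  have hz := Int.eq_zero_of_abs_lt_dvd h (abs_lt.mpr ⟨by lia, by lia⟩)
  lia

/-- BGV homomorphic multiplication correctness. With ciphertexts
`c = (c₁, c₂)`, `d = (d₁, d₂)` decrypting to `φ(N·e₁ + m₁)`, `φ(N·e₂ + m₂)` under the key
`s`, and `Mult(c,d) := (c₁d₁, c₁d₂ + c₂d₁, c₂d₂)`:
(i) `c₁d₁ + (c₁d₂ + c₂d₁)·φ(s) + c₂d₂·φ(s)² = φ((N·e₁ + m₁)(N·e₂ + m₂))`;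
(ii) if `r := (N·e₁ + m₁)(N·e₂ + m₂) mod (X^p + 1)` over `ℤ[X]` has all coefficients in
`[−q/2, q/2)`, then `r` is the unique polynomial of degree `< p` with coefficients in
`[−q/2, q/2)` satisfying `φ(r) = c₁d₁ + (c₁d₂ + c₂d₁)·φ(s) + c₂d₂·φ(s)²`, and the image
of `r` in `(ZMod N)[X]/(X^p+1)` equals that of `m₁·m₂`. -/
theorem stmt_19 (p N q : ℕ) (hp : 1 ≤ p) (hN : 2 ≤ N) (hq : 2 ≤ q)
    (s e₁ e₂ m₁ m₂ : Polynomial ℤ)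
    (c d : (Polynomial (ZMod q) ⧸ Ideal.span {((X : Polynomial (ZMod q)) ^ p + 1)}) ×
           (Polynomial (ZMod q) ⧸ Ideal.span {((X : Polynomial (ZMod q)) ^ p + 1)}))
    (hc : c.1 + c.2 * canonMap p q s = canonMap p q ((N : Polynomial ℤ) * e₁ + m₁))
    (hd : d.1 + d.2 * canonMap p q s = canonMap p q ((N : Polynomial ℤ) * e₂ + m₂)) :
    (c.1 * d.1 + (c.1 * d.2 + c.2 * d.1) * canonMap p q s
        + c.2 * d.2 * (canonMap p q s) ^ 2
      = canonMap p q (((N : Polynomial ℤ) * e₁ + m₁) * ((N : Polynomial ℤ) * e₂ + m₂))) ∧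
    (∀ r : Polynomial ℤ,
      r = (((N : Polynomial ℤ) * e₁ + m₁) * ((N : Polynomial ℤ) * e₂ + m₂)) %ₘ
        ((X : Polynomial ℤ) ^ p + 1) →
      (∀ i : ℕ, -(q : ℤ) ≤ 2 * r.coeff i ∧ 2 * r.coeff i < (q : ℤ)) →
      r.degree < (p : WithBot ℕ) ∧
      canonMap p q r = c.1 * d.1 + (c.1 * d.2 + c.2 * d.1) * canonMap p q s
        + c.2 * d.2 * (canonMap p q s) ^ 2 ∧
      (∀ r' : Polynomial ℤ, r'.degree < (p : WithBot ℕ) →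
        (∀ i : ℕ, -(q : ℤ) ≤ 2 * r'.coeff i ∧ 2 * r'.coeff i < (q : ℤ)) →
        canonMap p q r' = c.1 * d.1 + (c.1 * d.2 + c.2 * d.1) * canonMap p q s
          + c.2 * d.2 * (canonMap p q s) ^ 2 →
        r' = r) ∧
      canonMap p N r = canonMap p N (m₁ * m₂)) := by
  have hmul : c.1 * d.1 + (c.1 * d.2 + c.2 * d.1) * canonMap p q s
        + c.2 * d.2 * (canonMap p q s) ^ 2
      = canonMap p q (((N : Polynomial ℤ) * e₁ + m₁) * ((N : Polynomial ℤ) * e₂ + m₂)) := by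
    rw [map_mul, ← hc, ← hd]
    ring
  refine ⟨hmul, fun r hr hbound => ?_⟩
  have hdeg : r.degree < (p : WithBot ℕ) := by
    have hX : ((X : Polynomial ℤ) ^ p + 1).degree = p := by
      simpa using degree_X_pow_add_C (R := ℤ) (by lia : 0 < p) 1
    rw [hr, ← hX]
    exact degree_modByMonic_lt _ (monic_X_pow_add_one ℤ hp)
  have hφ : canonMap p q r = c.1 * d.1 + (c.1 * d.2 + c.2 * d.1) * canonMap p q s
      + c.2 * d.2 * (canonMap p q s) ^ 2 := by
    rw [hmul, hr, canonMap_modByMonic]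
  refine ⟨hdeg, hφ, fun r' hdeg' hbound' hφ' => ?_, ?_⟩
  · ext i
    exact eq_of_intCast_eq_of_mem_centered (hbound' i) (hbound i)
      (intCast_coeff_eq_of_canonMap_eq hp hq hdeg' hdeg (hφ'.trans hφ.symm) i)
  · rw [hr, canonMap_modByMonic]
    simp only [map_mul, map_add, canonMap_natCast_self, zero_mul, zero_add]
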